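/- The zeta function ζ_{φ_A}(s) of the flow φ_A on the one-sided suspension S_{A,b}^{l,k} of (X_A, σ_A) equals the dynamical zeta function with potential function c = l − k: ζ_{φ_A}(s) = ζ_{A,c}(s) = exp( Σ_{n=1}^∞ (1/n) Σ_{x ∈ Per_n(X_A)} exp(−s·Σ_{i=0}^{n−1} c(σ_A^i(x))) ), for complex s with sufficiently large real part. -/

import Mathlib

open scoped BigOperators NNReal

namespace OneSidedMarkov

variable {N M : ℕ}

/-- The matrix has entries in `{0, 1}`. -/
def IsZeroOne (A : Matrix (Fin N) (Fin N) ℤ) : Prop := ∀ i j, A i j = 0 ∨ A i j = 1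

/-- The matrix is irreducible. -/
def IsIrreducible (A : Matrix (Fin N) (Fin N) ℤ) : Prop :=
  ∀ i j, ∃ m : ℕ, 0 < m ∧ (A ^ m) i j ≠ 0

/-- The matrix is a permutation matrix. -/
def IsPermutationMatrix (A : Matrix (Fin N) (Fin N) ℤ) : Prop :=
  ∃ e : Equiv.Perm (Fin N), ∀ i j, A i j = if e i = j then 1 else 0

/-- The one-sided topological Markov shift space `X_A`. -/
abbrev Space (A : Matrix (Fin N) (Fin N) ℤ) : Type :=
  {x : ℕ → Fin N // ∀ n, A (x n) (x (n + 1)) = 1}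

/-- The shift map `σ_A`. -/
def shift (A : Matrix (Fin N) (Fin N) ℤ) (x : Space A) : Space A :=
  ⟨fun n => x.1 (n + 1), fun n => x.2 (n + 1)⟩

lemma continuous_shift (A : Matrix (Fin N) (Fin N) ℤ) : Continuous (shift A) := by
  apply Continuous.subtype_mk
  exact continuous_pi fun n => (continuous_apply (n + 1)).comp continuous_subtype_val

/-- The shift map as a continuous map. -/
def shiftMap (A : Matrix (Fin N) (Fin N) ℤ) : C(Space A, Space A) :=
  ⟨shift A, continuous_shift A⟩

/-- The coboundary subgroup `{ g - g ∘ σ_A }` of `C(X_A, ℤ)`. -/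
def cobdySubgroup (A : Matrix (Fin N) (Fin N) ℤ) : AddSubgroup C(Space A, ℤ) :=
  AddSubgroup.closure {f | ∃ g : C(Space A, ℤ), f = g - g.comp (shiftMap A)}

/-- The ordered cohomology group `H^A = C(X_A, ℤ)/{g - g∘σ_A}`. -/
abbrev Coh (A : Matrix (Fin N) (Fin N) ℤ) : Type :=
  C(Space A, ℤ) ⧸ cobdySubgroup A

/-- The class `[f] ∈ H^A`. -/
def cohClass (A : Matrix (Fin N) (Fin N) ℤ) (f : C(Space A, ℤ)) : Coh A :=
  QuotientAddGroup.mk f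

/-- The positive cone `H^A_+`. -/
def CohPos (A : Matrix (Fin N) (Fin N) ℤ) : Set (Coh A) :=
  {c | ∃ f : C(Space A, ℤ), (∀ x, 0 ≤ f x) ∧ c = cohClass A f}

/-- `u` is an order unit of `(H^A, H^A_+)`. -/
def IsOrderUnit (A : Matrix (Fin N) (Fin N) ℤ) (u : Coh A) : Prop :=
  u ∈ CohPos A ∧ ∀ g : Coh A, ∃ n : ℕ, 0 < n ∧ n • u - g ∈ CohPos A

/-- The data `(l, k, b)` of a suspension. -/
structure SuspData (A : Matrix (Fin N) (Fin N) ℤ) where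
  l : C(Space A, ℝ)
  k : C(Space A, ℝ)
  b : C(Space A, ℝ)

/-- `c = l - k`. -/
def cFun {A : Matrix (Fin N) (Fin N) ℤ} (T : SuspData A) (x : Space A) : ℝ :=
  T.l x - T.k x

/-- `(l, k, b)` is a suspension triplet for `(X_A, σ_A)`. -/
def IsSuspTriplet {A : Matrix (Fin N) (Fin N) ℤ} (T : SuspData A) : Prop :=
  (∀ x, 0 ≤ T.l x) ∧ (∀ x, 0 ≤ T.k x) ∧
  (∃ c : C(Space A, ℤ), (∀ x, (c x : ℝ) = cFun T x) ∧ IsOrderUnit A (cohClass A c)) ∧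
  (∀ x, ∃ m : ℕ, T.l x - T.b x = m) ∧
  (∀ x, ∃ m : ℕ, T.k x - T.b (shift A x) = m)

/-- The space `X_{A,b}^ℝ = {(x, r) : r ≥ b(x)}`. -/
abbrev BaseSpace {A : Matrix (Fin N) (Fin N) ℤ} (T : SuspData A) : Type :=
  {p : Space A × ℝ // T.b p.1 ≤ p.2}

/-- The elementary relation `(x, r) ∼ (σ_A(x), r - c(x))` for `r ≥ l(x)`. -/
def SuspRel {A : Matrix (Fin N) (Fin N) ℤ} (T : SuspData A)
    (p q : BaseSpace T) : Prop :=
  T.l p.1.1 ≤ p.1.2 ∧ q.1 = (shift A p.1.1, p.1.2 - cFun T p.1.1)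

/-- The equivalence relation `∼_{l,k}` generated by `SuspRel`. -/
def suspSetoid {A : Matrix (Fin N) (Fin N) ℤ} (T : SuspData A) : Setoid (BaseSpace T) :=
  ⟨Relation.EqvGen (SuspRel T), Relation.EqvGen.is_equivalence _⟩

/-- The one-sided suspension `S_{A,b}^{l,k}` with the quotient topology. -/
abbrev Susp {A : Matrix (Fin N) (Fin N) ℤ} (T : SuspData A) : Type :=
  Quotient (suspSetoid T)

/-- The class `[x, r]`. -/
def mkSusp {A : Matrix (Fin N) (Fin N) ℤ} (T : SuspData A) (p : BaseSpace T) : Susp T :=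
  Quotient.mk (suspSetoid T) p

/-- The base map `x ↦ [x, b(x)]`. -/
def basePoint {A : Matrix (Fin N) (Fin N) ℤ} (T : SuspData A) (x : Space A) : Susp T :=
  mkSusp T ⟨(x, T.b x), le_refl _⟩

/-- Translation by `t ≥ 0` on `X_{A,b}^ℝ`. -/
def shiftPt {A : Matrix (Fin N) (Fin N) ℤ} (T : SuspData A) (t : ℝ≥0)
    (p : BaseSpace T) : BaseSpace T :=
  ⟨(p.1.1, p.1.2 + t), le_trans p.2 (le_add_of_nonneg_right t.2)⟩

lemma suspRel_shiftPt {A : Matrix (Fin N) (Fin N) ℤ} (T : SuspData A) (t : ℝ≥0)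
    {p q : BaseSpace T} (h : SuspRel T p q) : SuspRel T (shiftPt T t p) (shiftPt T t q) := by
  obtain ⟨h1, h2⟩ := h
  refine ⟨le_trans h1 (le_add_of_nonneg_right t.2), ?_⟩
  show (q.1.1, q.1.2 + (t : ℝ)) = _
  rw [h2]
  show (shift A p.1.1, p.1.2 - cFun T p.1.1 + (t : ℝ))
      = (shift A p.1.1, p.1.2 + (t : ℝ) - cFun T p.1.1)
  congr 1
  ring

lemma eqvGen_map {α : Type*} {r r' : α → α → Prop} (f : α → α)
    (hf : ∀ a b, r a b → r' (f a) (f b)) :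
    ∀ a b, Relation.EqvGen r a b → Relation.EqvGen r' (f a) (f b) := by
  intro a b h
  induction h with
  | rel a b hab => exact Relation.EqvGen.rel _ _ (hf a b hab)
  | refl a => exact Relation.EqvGen.refl _
  | symm a b _ ih => exact Relation.EqvGen.symm _ _ ih
  | trans a b c _ _ ih1 ih2 => exact Relation.EqvGen.trans _ _ _ ih1 ih2

/-- The flow `φ_{A,t}([x, r]) = [x, r + t]`, `t ∈ ℝ_+`, on the one-sided suspension. -/
def flow {A : Matrix (Fin N) (Fin N) ℤ} (T : SuspData A) (t : ℝ≥0) :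
    Susp T → Susp T :=
  Quotient.map' (shiftPt T t)
    (fun p q h => eqvGen_map (shiftPt T t) (fun _ _ hr => suspRel_shiftPt T t hr) p q h)

/-- The standard suspension data `(1, 0, 0)`. -/
def stdData (A : Matrix (Fin N) (Fin N) ℤ) : SuspData A := ⟨1, 0, 0⟩

/-- The standard one-sided suspension `S_A^1`. -/
abbrev StdSusp (A : Matrix (Fin N) (Fin N) ℤ) : Type := Susp (stdData A)

/-- The standard base map `s_A(x) = [x, 0]`. -/
def stdBase (A : Matrix (Fin N) (Fin N) ℤ) : Space A → StdSusp A :=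
  basePoint (stdData A)

/-- The orbit equations of a continuous orbit equivalence. -/
def OrbitEqFns (A : Matrix (Fin N) (Fin N) ℤ) (B : Matrix (Fin M) (Fin M) ℤ)
    (h : Space A ≃ₜ Space B) (k1 l1 : C(Space A, ℕ)) (k2 l2 : C(Space B, ℕ)) : Prop :=
  (∀ x : Space A, (shift B)^[k1 x] (h (shift A x)) = (shift B)^[l1 x] (h x)) ∧
  (∀ y : Space B, (shift A)^[k2 y] (h.symm (shift B y)) = (shift A)^[l2 y] (h.symm y))

/-- `(X_A, σ_A)` and `(X_B, σ_B)` are continuously orbit equivalent. -/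
def ContOrbitEquiv (A : Matrix (Fin N) (Fin N) ℤ) (B : Matrix (Fin M) (Fin M) ℤ) : Prop :=
  ∃ h : Space A ≃ₜ Space B, ∃ k1 l1 : C(Space A, ℕ), ∃ k2 l2 : C(Space B, ℕ),
    OrbitEqFns A B h k1 l1 k2 l2

/-- One-sided flow equivalence via the homeomorphism `h`. -/
def FlowEquivVia (A : Matrix (Fin N) (Fin N) ℤ) (B : Matrix (Fin M) (Fin M) ℤ)
    (h : Space A ≃ₜ Space B) : Prop :=
  ∃ T₁ : SuspData A, IsSuspTriplet T₁ ∧ ∃ T₂ : SuspData B, IsSuspTriplet T₂ ∧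
  ∃ Φ₁ : Susp T₁ → StdSusp B, Continuous Φ₁ ∧
  ∃ Φ₂ : Susp T₂ → StdSusp A, Continuous Φ₂ ∧
  (∀ (t : ℝ≥0) (p : Susp T₁), Φ₁ (flow T₁ t p) = flow (stdData B) t (Φ₁ p)) ∧
  (∀ x : Space A, Φ₁ (basePoint T₁ x) = stdBase B (h x)) ∧
  (∀ (t : ℝ≥0) (q : Susp T₂), Φ₂ (flow T₂ t q) = flow (stdData A) t (Φ₂ q)) ∧
  (∀ y : Space B, Φ₂ (basePoint T₂ y) = stdBase A (h.symm y))

/-- `(X_A, σ_A)` and `(X_B, σ_B)` are one-sided flow equivalent. -/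
def OneSidedFlowEquiv (A : Matrix (Fin N) (Fin N) ℤ) (B : Matrix (Fin M) (Fin M) ℤ) : Prop :=
  ∃ h : Space A ≃ₜ Space B, FlowEquivVia A B h

/-- `f^m(x) = Σ_{i<m} f(σ_A^i(x))` for integer-valued `f`. -/
def birk (A : Matrix (Fin N) (Fin N) ℤ) (f : Space A → ℤ) (m : ℕ) (x : Space A) : ℤ :=
  ∑ i ∈ Finset.range m, f ((shift A)^[i] x)

/-- `f^m(x) = Σ_{i<m} f(σ_A^i(x))` for real-valued `f`. -/
def birkR (A : Matrix (Fin N) (Fin N) ℤ) (f : Space A → ℝ) (m : ℕ) (x : Space A) : ℝ :=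
  ∑ i ∈ Finset.range m, f ((shift A)^[i] x)

/-- `f^m(x) = Σ_{i<m} f(σ_A^i(x))` for ℕ-valued `f`. -/
def birkN (A : Matrix (Fin N) (Fin N) ℤ) (f : Space A → ℕ) (m : ℕ) (x : Space A) : ℕ :=
  ∑ i ∈ Finset.range m, f ((shift A)^[i] x)

/-- The map `Ψ_h` associated with a continuous orbit equivalence. -/
def psi (A : Matrix (Fin N) (Fin N) ℤ) (B : Matrix (Fin M) (Fin M) ℤ)
    (h : Space A → Space B) (l1 k1 : Space A → ℕ) (f : Space B → ℤ) :
    Space A → ℤ :=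
  fun x => (∑ i ∈ Finset.range (l1 x), f ((shift B)^[i] (h x)))
    - ∑ j ∈ Finset.range (k1 x), f ((shift B)^[j] (h (shift A x)))

/-- The dynamical zeta function `ζ_{A,f}(s)` with potential `f`. -/
noncomputable def zeta (A : Matrix (Fin N) (Fin N) ℤ) (f : Space A → ℤ) (s : ℂ) : ℂ :=
  Complex.exp (∑' n : ℕ, (1 / (n + 1 : ℂ)) *
    ∑' x : {x : Space A // (shift A)^[n + 1] x = x},
      Complex.exp (-s * ((birk A f (n + 1) x.1 : ℤ) : ℂ)))

/-- `γ` is a periodic orbit of `(X_A, σ_A)`. -/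
def IsPerOrbit (A : Matrix (Fin N) (Fin N) ℤ) (γ : Set (Space A)) : Prop :=
  ∃ (x : Space A) (p : ℕ), 0 < p ∧ (shift A)^[p] x = x ∧
    (∀ q : ℕ, 0 < q → (shift A)^[q] x = x → p ≤ q) ∧
    γ = {y | ∃ i : ℕ, i < p ∧ y = (shift A)^[i] x}

/-- `τ` is a primitive periodic orbit of the flow on the one-sided suspension. -/
def IsFlowOrbit {A : Matrix (Fin N) (Fin N) ℤ} (T : SuspData A) (τ : Set (Susp T)) : Prop :=
  ∃ u : Susp T, (∃ t : ℝ≥0, 0 < t ∧ flow T t u = u) ∧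
    τ = Set.range (fun t : ℝ≥0 => flow T t u)

/-- `ℓ(u) = min { t > 0 : φ_{A,t}(u) = u }`. -/
noncomputable def pointLen {A : Matrix (Fin N) (Fin N) ℤ} (T : SuspData A) (u : Susp T) : ℝ≥0 :=
  sInf {t : ℝ≥0 | 0 < t ∧ flow T t u = u}

/-- `ℓ(τ) = min { t > 0 : φ_{A,t}(u) = u for all u ∈ τ }`. -/
noncomputable def orbitLen {A : Matrix (Fin N) (Fin N) ℤ} (T : SuspData A)
    (τ : Set (Susp T)) : ℝ≥0 :=
  sInf {t : ℝ≥0 | 0 < t ∧ ∀ u ∈ τ, flow T t u = u}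

open Function Relation

section Periodic

/-- Periodic points only return at multiples of the period, so the Birkhoff sums agree up to
multiples of the Birkhoff sum over one period. -/
lemma birkhoffSum_add_mul_of_isPeriodicPt {α M : Type*} [AddCommMonoid M] {f : α → α} {x : α}
    {p : ℕ} (hx : IsPeriodicPt f p x) (g : α → M) (m j : ℕ) :
    birkhoffSum f g (m + p * j) x = birkhoffSum f g m x + j • birkhoffSum f g p x := by
  induction j with
  | zero => simp
  | succ j ih =>
    have : m + p * (j + 1) = p + (m + p * j) := by ring
    rw [this, birkhoffSum_add, hx.eq, ih, succ_nsmul, add_comm, add_assoc]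

lemma exists_eq_add_minimalPeriod_mul {α : Type*} {f : α → α} {x : α} (hx : x ∈ periodicPts f)
    {m n : ℕ} (hmn : m ≤ n) (h : f^[n] x = f^[m] x) : ∃ j, n = m + minimalPeriod f x * j := by
  obtain ⟨d, rfl⟩ := Nat.exists_eq_add_of_le hmn
  have hd : IsPeriodicPt f d (f^[m] x) := by
    rw [IsPeriodicPt, IsFixedPt, ← iterate_add_apply, add_comm d m, h]
  obtain ⟨j, hj⟩ := minimalPeriod_apply_iterate hx m ▸ hd.minimalPeriod_dvd
  exact ⟨j, by rw [hj]⟩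

lemma exists_iterate_iterate_eq {α : Type*} {f : α → α} {x : α} (hx : x ∈ periodicPts f)
    (m : ℕ) : ∃ i, f^[i] (f^[m] x) = x := by
  have hp := minimalPeriod_pos_of_mem_periodicPts hx
  refine ⟨minimalPeriod f x * m - m, ?_⟩
  rw [← iterate_add_apply, Nat.sub_add_cancel (Nat.le_mul_of_pos_left m hp)]
  exact (isPeriodicPt_minimalPeriod f x).mul_const m

lemma birkhoffSum_coboundary_of_isPeriodicPt {A : Matrix (Fin N) (Fin N) ℤ}
    {f : C(Space A, ℤ)} (hf : f ∈ cobdySubgroup A) {x : Space A} {n : ℕ}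
    (hx : IsPeriodicPt (shift A) n x) : birkhoffSum (shift A) f n x = 0 := by
  induction hf using AddSubgroup.closure_induction with
  | mem f hf =>
    obtain ⟨g, rfl⟩ := hf
    have h2 : birkhoffSum (shift A) (⇑(g - g.comp (shiftMap A))) n x
        = birkhoffSum (shift A) g n x - birkhoffSum (shift A) g n (shift A x) := by
      simp only [birkhoffSum, ← Finset.sum_sub_distrib]
      refine Finset.sum_congr rfl fun i _ => ?_
      rw [← iterate_succ_apply, iterate_succ_apply']
      rfl
    have h3 := birkhoffSum_apply_sub_birkhoffSum (shift A) g n x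
    rw [hx.eq, sub_self] at h3
    rw [h2]; linarith
  | zero => simp [birkhoffSum]
  | add f g _ _ h1 h2 =>
    have : birkhoffSum (shift A) (⇑(f + g)) n x
      = birkhoffSum (shift A) f n x + birkhoffSum (shift A) g n x := by
        simp [birkhoffSum, Finset.sum_add_distrib]
    rw [this, h1, h2, add_zero]
  | neg f _ h =>
    have : birkhoffSum (shift A) (⇑(-f)) n x = - birkhoffSum (shift A) f n x := by
        simp [birkhoffSum]
    rw [this, h, neg_zero]

/-- An order unit has Birkhoff sums over periodic orbits growing at least linearly with the
period. -/
lemma IsSuspTriplet.exists_le_birkR {A : Matrix (Fin N) (Fin N) ℤ} {T : SuspData A}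
    (hT : IsSuspTriplet T) : ∃ n₀ : ℕ, 0 < n₀ ∧ ∀ (x : Space A) (n : ℕ),
      IsPeriodicPt (shift A) n x → (n : ℝ) ≤ n₀ * birkR A (cFun T) n x := by
  obtain ⟨-, -, ⟨c, hc, -, hu⟩, -, -⟩ := hT
  obtain ⟨n₀, hn₀, f, hf, hfe⟩ := hu (cohClass A 1)
  refine ⟨n₀, hn₀, fun x n hx => ?_⟩
  have hmem : -(n₀ • c - 1) + f ∈ cobdySubgroup A := by
    rw [← QuotientAddGroup.eq]
    exact hfe
  have h0 := birkhoffSum_coboundary_of_isPeriodicPt hmem hx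
  have h1 : birkhoffSum (shift A) (⇑(-(n₀ • c - 1) + f)) n x
      = -(n₀ * birkhoffSum (shift A) c n x) + n + birkhoffSum (shift A) f n x := by
    simp [birkhoffSum, Finset.sum_add_distrib, Finset.mul_sum]
    ring
  have h2 : 0 ≤ birkhoffSum (shift A) f n x := Finset.sum_nonneg fun i _ => hf _
  have h3 : (n : ℤ) ≤ n₀ * birkhoffSum (shift A) c n x := by linarith
  have h4 : ((birkhoffSum (shift A) c n x : ℤ) : ℝ) = birkR A (cFun T) n x := by
    simp [birkhoffSum, birkR, hc]
  rw [← h4]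
  exact_mod_cast h3

end Periodic

section Suspension

variable {A : Matrix (Fin N) (Fin N) ℤ} {T : SuspData A}

lemma join_of_mkSusp_eq {p q : BaseSpace T} (h : mkSusp T p = mkSusp T q) :
    Join (ReflTransGen (SuspRel T)) p q := by
  have hE : Equivalence (Join (ReflTransGen (SuspRel T))) :=
    equivalence_join_reflTransGen fun a b c hab hac => by
      obtain rfl : b = c := Subtype.ext (hab.2.trans hac.2.symm)
      exact ⟨b, .refl, .refl⟩
  have h' : EqvGen (SuspRel T) p q := Quotient.exact h
  induction h' with
  | rel a b hab => exact ⟨b, .single hab, .refl⟩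
  | refl a => exact hE.refl a
  | symm a b hab ih => exact hE.symm (ih (Quotient.sound hab))
  | trans a b c hab hbc ih1 ih2 =>
    exact hE.trans (ih1 (Quotient.sound hab)) (ih2 (Quotient.sound hbc))

lemma exists_iterate_of_reflTransGen {p q : BaseSpace T}
    (h : ReflTransGen (SuspRel T) p q) : ∃ n : ℕ,
      q.1 = ((shift A)^[n] p.1.1, p.1.2 - birkR A (cFun T) n p.1.1) := by
  induction h with
  | refl => exact ⟨0, by simp [birkR]⟩
  | tail _ hbc ih =>
    obtain ⟨n, hn⟩ := ih
    refine ⟨n + 1, ?_⟩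
    rw [hbc.2, hn, iterate_succ_apply']
    refine Prod.ext rfl ?_
    simp only [birkR, Finset.sum_range_succ]
    ring

/-- Equal points of the suspension have a common forward image in the base space. -/
lemma exists_iterate_eq_of_mkSusp_eq {p q : BaseSpace T} (h : mkSusp T p = mkSusp T q) :
    ∃ n m : ℕ, (shift A)^[n] p.1.1 = (shift A)^[m] q.1.1 ∧
      p.1.2 - birkR A (cFun T) n p.1.1 = q.1.2 - birkR A (cFun T) m q.1.1 := by
  obtain ⟨d, hpd, hqd⟩ := join_of_mkSusp_eq h
  obtain ⟨n, hn⟩ := exists_iterate_of_reflTransGen hpd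
  obtain ⟨m, hm⟩ := exists_iterate_of_reflTransGen hqd
  have := hn.symm.trans hm
  exact ⟨n, m, congrArg Prod.fst this, congrArg Prod.snd this⟩

/-- High enough above a point of the base, the identifications can be iterated `n` times. -/
lemma exists_mkSusp_eq_iterate (hT : IsSuspTriplet T) (x : Space A) (n : ℕ) :
    ∃ R : ℝ, T.b x ≤ R ∧ ∀ (r : ℝ) (hr : T.b x ≤ r), R ≤ r →
      ∃ hr' : T.b ((shift A)^[n] x) ≤ r - birkR A (cFun T) n x,
        mkSusp T ⟨(x, r), hr⟩
          = mkSusp T ⟨((shift A)^[n] x, r - birkR A (cFun T) n x), hr'⟩ := by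
  induction n with
  | zero =>
    refine ⟨T.b x, le_rfl, fun r hr _ => ⟨by simpa [birkR] using hr, ?_⟩⟩
    congr 1
    simp [birkR]
  | succ n ih =>
    obtain ⟨R, hbR, hR⟩ := ih
    refine ⟨max R (T.l ((shift A)^[n] x) + birkR A (cFun T) n x), hbR.trans (le_max_left _ _),
      fun r hr hRr => ?_⟩
    obtain ⟨hr1, he⟩ := hR r hr ((le_max_left _ _).trans hRr)
    have hl : T.l ((shift A)^[n] x) ≤ r - birkR A (cFun T) n x := by
      linarith [(le_max_right _ _).trans hRr]
    have hs : r - birkR A (cFun T) (n + 1) x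
        = r - birkR A (cFun T) n x - cFun T ((shift A)^[n] x) := by
      simp only [birkR, Finset.sum_range_succ]; ring
    have hr2 : T.b ((shift A)^[n + 1] x) ≤ r - birkR A (cFun T) (n + 1) x := by
      obtain ⟨m, hm⟩ := hT.2.2.2.2 ((shift A)^[n] x)
      rw [iterate_succ_apply', hs, cFun]
      have : (0 : ℝ) ≤ m := m.cast_nonneg
      linarith
    refine ⟨hr2, he.trans (Quotient.sound (EqvGen.rel _ _ ⟨hl, ?_⟩))⟩
    exact Prod.ext (iterate_succ_apply' _ _ _) hs

lemma flow_mkSusp (t : ℝ≥0) (p : BaseSpace T) :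
    flow T t (mkSusp T p) = mkSusp T (shiftPt T t p) := rfl

lemma flow_flow (s t : ℝ≥0) (u : Susp T) : flow T s (flow T t u) = flow T (t + s) u := by
  induction u using Quotient.inductionOn with
  | h p =>
    change mkSusp T _ = mkSusp T _
    congr 1
    exact Subtype.ext (Prod.ext rfl (by simp [shiftPt, add_assoc]))

lemma flow_zero (u : Susp T) : flow T 0 u = u := by
  induction u using Quotient.inductionOn with
  | h p =>
    change mkSusp T _ = mkSusp T _
    congr 1
    exact Subtype.ext (Prod.ext rfl (by simp [shiftPt]))

lemma flow_nsmul {t : ℝ≥0} {u : Susp T} (h : flow T t u = u) (n : ℕ) :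
    flow T (n • t) u = u := by
  induction n with
  | zero => rw [zero_nsmul, flow_zero]
  | succ n ih => rw [succ_nsmul, ← flow_flow, ih, h]

/-- The orbit of a periodic point of the flow is the orbit of any of its points. -/
lemma range_flow_flow {t : ℝ≥0} {u : Susp T} (ht : 0 < t) (h : flow T t u = u) (s : ℝ≥0) :
    Set.range (fun a => flow T a (flow T s u)) = Set.range (fun a => flow T a u) := by
  ext v
  simp only [Set.mem_range, flow_flow]
  constructor
  · rintro ⟨a, rfl⟩
    exact ⟨_, rfl⟩
  · rintro ⟨a, rfl⟩
    obtain ⟨n, hn⟩ := Archimedean.arch s ht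
    refine ⟨n • t - s + a, ?_⟩
    rw [← add_assoc, add_tsub_cancel_of_le hn, ← flow_flow, flow_nsmul h]

lemma mkSusp_eq_flow {x : Space A} {r r' : ℝ} (h : T.b x ≤ r) (h' : T.b x ≤ r') (hrr : r ≤ r') :
    mkSusp T ⟨(x, r'), h'⟩ = flow T (r' - r).toNNReal (mkSusp T ⟨(x, r), h⟩) := by
  rw [flow_mkSusp]
  congr 1
  exact Subtype.ext (Prod.ext rfl (by simp [shiftPt, hrr]))

lemma IsSuspTriplet.birkR_minimalPeriod_pos (hT : IsSuspTriplet T) {x : Space A}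
    (hx : x ∈ periodicPts (shift A)) :
    0 < birkR A (cFun T) (minimalPeriod (shift A) x) x := by
  obtain ⟨n₀, hn₀, h⟩ := hT.exists_le_birkR
  have h1 := h x _ (isPeriodicPt_minimalPeriod _ x)
  have h2 : (0 : ℝ) < minimalPeriod (shift A) x := by
    exact_mod_cast minimalPeriod_pos_of_mem_periodicPts hx
  exact pos_of_mul_pos_right (h2.trans_le h1) n₀.cast_nonneg

/-- A height above which the identifications along one period of `x` are available. -/
noncomputable def periodicHeight (hT : IsSuspTriplet T) (x : Space A) : ℝ :=
  (exists_mkSusp_eq_iterate hT x (minimalPeriod (shift A) x)).choose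

lemma le_periodicHeight (hT : IsSuspTriplet T) (x : Space A) : T.b x ≤ periodicHeight hT x :=
  (exists_mkSusp_eq_iterate hT x (minimalPeriod (shift A) x)).choose_spec.1

/-- The closed orbit of the flow lying over a periodic point of the shift. -/
def liftOrbit (hT : IsSuspTriplet T) (x : Space A) : Set (Susp T) :=
  Set.range fun t : ℝ≥0 => flow T t (mkSusp T ⟨(x, periodicHeight hT x), le_periodicHeight hT x⟩)

lemma flow_birkR_mkSusp (hT : IsSuspTriplet T) {x : Space A} (hx : x ∈ periodicPts (shift A))
    {r : ℝ} (hr : T.b x ≤ r) (hrx : periodicHeight hT x ≤ r) :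
    flow T (birkR A (cFun T) (minimalPeriod (shift A) x) x).toNNReal (mkSusp T ⟨(x, r), hr⟩)
      = mkSusp T ⟨(x, r), hr⟩ := by
  have hpos := hT.birkR_minimalPeriod_pos hx
  set ℓ := birkR A (cFun T) (minimalPeriod (shift A) x) x with hℓ
  have hr2 : T.b x ≤ r + ℓ := by linarith
  obtain ⟨h1, h2⟩ := (exists_mkSusp_eq_iterate hT x (minimalPeriod (shift A) x)).choose_spec.2
    (r + ℓ) hr2 (by change periodicHeight hT x ≤ _; linarith)
  have h3 := mkSusp_eq_flow hr hr2 (by linarith)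
  rw [add_sub_cancel_left] at h3
  rw [← h3, h2]
  congr 1
  refine Subtype.ext (Prod.ext iterate_minimalPeriod ?_)
  simp [← hℓ]

lemma range_flow_mkSusp (hT : IsSuspTriplet T) {x : Space A} (hx : x ∈ periodicPts (shift A))
    {r : ℝ} (hr : T.b x ≤ r) (hrx : periodicHeight hT x ≤ r) :
    Set.range (fun t => flow T t (mkSusp T ⟨(x, r), hr⟩)) = liftOrbit hT x := by
  rw [mkSusp_eq_flow (le_periodicHeight hT x) hr hrx]
  exact range_flow_flow (Real.toNNReal_pos.2 (hT.birkR_minimalPeriod_pos hx))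
    (flow_birkR_mkSusp hT hx _ le_rfl) _

lemma isFlowOrbit_liftOrbit (hT : IsSuspTriplet T) {x : Space A}
    (hx : x ∈ periodicPts (shift A)) : IsFlowOrbit T (liftOrbit hT x) :=
  ⟨_, ⟨_, Real.toNNReal_pos.2 (hT.birkR_minimalPeriod_pos hx),
    flow_birkR_mkSusp hT hx (le_periodicHeight hT x) le_rfl⟩, rfl⟩

lemma liftOrbit_iterate (hT : IsSuspTriplet T) {x : Space A} (hx : x ∈ periodicPts (shift A))
    (i : ℕ) : liftOrbit hT ((shift A)^[i] x) = liftOrbit hT x := by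
  have hy : (shift A)^[i] x ∈ periodicPts (shift A) :=
    let ⟨n, hn, h⟩ := hx; ⟨n, hn, h.apply_iterate i⟩
  obtain ⟨R, hbR, hR⟩ := exists_mkSusp_eq_iterate hT x i
  let r := max R (max (periodicHeight hT x)
    (periodicHeight hT ((shift A)^[i] x) + birkR A (cFun T) i x))
  have h1 : periodicHeight hT x ≤ r := (le_max_left _ _).trans (le_max_right _ _)
  have h2 : periodicHeight hT ((shift A)^[i] x) + birkR A (cFun T) i x ≤ r :=
    (le_max_right _ _).trans (le_max_right _ _)
  obtain ⟨hr', he⟩ := hR r (hbR.trans (le_max_left _ _)) (le_max_left _ _)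
  rw [← range_flow_mkSusp hT hx (hbR.trans (le_max_left _ _)) h1, he,
    range_flow_mkSusp hT hy hr' (by linarith)]

lemma liftOrbit_eq_iff (hT : IsSuspTriplet T) {x y : Space A} (hx : x ∈ periodicPts (shift A))
    (hy : y ∈ periodicPts (shift A)) :
    liftOrbit hT y = liftOrbit hT x ↔ ∃ i, (shift A)^[i] x = y := by
  constructor
  · intro h
    have hmem : mkSusp T ⟨(x, periodicHeight hT x), le_periodicHeight hT x⟩ ∈ liftOrbit hT y := by
      rw [h]
      exact ⟨0, flow_zero _⟩
    obtain ⟨t, ht⟩ := hmem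
    obtain ⟨n, m, hnm, -⟩ := exists_iterate_eq_of_mkSusp_eq ht
    obtain ⟨i, hi⟩ := exists_iterate_iterate_eq hy n
    refine ⟨i + m, ?_⟩
    rw [iterate_add_apply, ← hi]
    exact congrArg _ hnm.symm
  · rintro ⟨i, rfl⟩
    exact liftOrbit_iterate hT hx i

/-- Every closed orbit of the flow lies over a periodic point of the shift. -/
lemma IsFlowOrbit.exists_eq_liftOrbit (hT : IsSuspTriplet T) {τ : Set (Susp T)}
    (hτ : IsFlowOrbit T τ) : ∃ x ∈ periodicPts (shift A), liftOrbit hT x = τ := by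
  obtain ⟨u, ⟨t, ht, hu⟩, rfl⟩ := hτ
  induction u using Quotient.inductionOn with
  | h p =>
  obtain ⟨⟨x, r⟩, hr⟩ := p
  change flow T t (mkSusp T ⟨(x, r), hr⟩) = mkSusp T ⟨(x, r), hr⟩ at hu
  change ∃ y ∈ _, _ = Set.range fun t => flow T t (mkSusp T ⟨(x, r), hr⟩)
  obtain ⟨n, m, h1, h2⟩ := exists_iterate_eq_of_mkSusp_eq hu
  change (shift A)^[n] x = (shift A)^[m] x at h1
  change r + (t : ℝ) - birkR A (cFun T) n x = r - birkR A (cFun T) m x at h2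
  have hnm : n ≠ m := by
    rintro rfl
    have : (0 : ℝ) < t := ht
    linarith
  have hper : (shift A)^[min n m] x ∈ periodicPts (shift A) := by
    rcases lt_or_gt_of_ne hnm with h | h
    · rw [min_eq_left h.le]
      refine mk_mem_periodicPts (n := m - n) (by omega) ?_
      rw [IsPeriodicPt, IsFixedPt, ← iterate_add_apply, Nat.sub_add_cancel h.le, h1]
    · rw [min_eq_right h.le]
      refine mk_mem_periodicPts (n := n - m) (by omega) ?_
      rw [IsPeriodicPt, IsFixedPt, ← iterate_add_apply, Nat.sub_add_cancel h.le, h1]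
  generalize min n m = q at hper
  obtain ⟨R, hbR, hR⟩ := exists_mkSusp_eq_iterate hT x q
  obtain ⟨j, hj⟩ := Archimedean.arch
    (max (R - r) (periodicHeight hT ((shift A)^[q] x) + birkR A (cFun T) q x - r))
    (show (0 : ℝ) < t from ht)
  have hj1 := (le_max_left _ _).trans hj
  have hj2 := (le_max_right _ _).trans hj
  have hjt : r + ((j • t : ℝ≥0) : ℝ) = r + j • (t : ℝ) := by simp
  have e1 : mkSusp T ⟨(x, r), hr⟩
      = mkSusp T ⟨(x, r + ((j • t : ℝ≥0) : ℝ)), hr.trans (le_add_of_nonneg_right (j • t).2)⟩ :=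
    (flow_nsmul hu j).symm
  obtain ⟨hr', e2⟩ := hR (r + ((j • t : ℝ≥0) : ℝ))
    (hr.trans (le_add_of_nonneg_right (j • t).2)) (by rw [hjt]; linarith)
  refine ⟨_, hper, ?_⟩
  rw [e1, e2, range_flow_mkSusp hT hper hr' (by rw [hjt]; linarith)]

lemma orbitLen_liftOrbit (hT : IsSuspTriplet T) {x : Space A} (hx : x ∈ periodicPts (shift A)) :
    (orbitLen T (liftOrbit hT x) : ℝ) = birkR A (cFun T) (minimalPeriod (shift A) x) x := by
  have hpos := hT.birkR_minimalPeriod_pos hx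
  have hfix := flow_birkR_mkSusp hT hx (le_periodicHeight hT x) le_rfl
  set ℓ := birkR A (cFun T) (minimalPeriod (shift A) x) x with hℓ
  have hleast : IsLeast {t : ℝ≥0 | 0 < t ∧ ∀ u ∈ liftOrbit hT x, flow T t u = u} ℓ.toNNReal := by
    refine ⟨⟨Real.toNNReal_pos.2 hpos, ?_⟩, ?_⟩
    · rintro _ ⟨s, rfl⟩
      simp only [flow_flow]
      rw [add_comm, ← flow_flow, hfix]
    · rintro t ⟨ht, htu⟩
      have ht0 : (0 : ℝ) < t := ht
      have h := htu _ ⟨0, flow_zero _⟩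
      obtain ⟨n, m, h1, h2⟩ := exists_iterate_eq_of_mkSusp_eq h
      change (shift A)^[n] x = (shift A)^[m] x at h1
      change periodicHeight hT x + (t : ℝ) - birkR A (cFun T) n x
        = periodicHeight hT x - birkR A (cFun T) m x at h2
      have key : ∀ a j : ℕ, birkR A (cFun T) (a + minimalPeriod (shift A) x * j) x
          = birkR A (cFun T) a x + j * ℓ := fun a j => by
        rw [← nsmul_eq_mul]
        exact birkhoffSum_add_mul_of_isPeriodicPt (isPeriodicPt_minimalPeriod _ x) _ a j
      refine Real.toNNReal_le_iff_le_coe.2 ?_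
      rcases le_total m n with hmn | hmn
      · obtain ⟨j, rfl⟩ := exists_eq_add_minimalPeriod_mul hx hmn h1
        rw [key] at h2
        have hj : j ≠ 0 := by
          rintro rfl
          simp at h2
          linarith
        have : (1 : ℝ) ≤ j := by exact_mod_cast Nat.one_le_iff_ne_zero.2 hj
        nlinarith
      · obtain ⟨j, rfl⟩ := exists_eq_add_minimalPeriod_mul hx hmn h1.symm
        rw [key] at h2
        have : (0 : ℝ) ≤ j := j.cast_nonneg
        nlinarith
  rw [orbitLen, hleast.csInf_eq, Real.coe_toNNReal _ hpos.le]

/-- The periodic points over which a given closed orbit lies form one orbit of the shift. -/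
lemma card_liftOrbit_eq (hT : IsSuspTriplet T) {x : Space A} (hx : x ∈ periodicPts (shift A)) :
    Nat.card {y : periodicPts (shift A) // liftOrbit hT y.1 = liftOrbit hT x}
      = minimalPeriod (shift A) x := by
  have hp := minimalPeriod_pos_of_mem_periodicPts hx
  let e : Fin (minimalPeriod (shift A) x) →
      {y : periodicPts (shift A) // liftOrbit hT y.1 = liftOrbit hT x} := fun i =>
    ⟨⟨(shift A)^[i] x, let ⟨n, hn, h⟩ := hx; ⟨n, hn, h.apply_iterate i⟩⟩,
      liftOrbit_iterate hT hx i⟩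
  have he : Bijective e := by
    constructor
    · intro i j hij
      have : (shift A)^[i] x = (shift A)^[j] x := congrArg (fun z => z.1.1) hij
      exact Fin.ext ((iterate_eq_iterate_iff_of_lt_minimalPeriod i.2 j.2).1 this)
    · rintro ⟨⟨y, hy⟩, hyx⟩
      obtain ⟨i, hi⟩ := (liftOrbit_eq_iff hT hx hy).1 hyx
      exact ⟨⟨i % _, Nat.mod_lt _ hp⟩,
        Subtype.ext (Subtype.ext (iterate_mod_minimalPeriod_eq.trans hi))⟩
  rw [← Nat.card_eq_of_bijective e he, Nat.card_fin]

end Suspension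

section Zeta

variable {A : Matrix (Fin N) (Fin N) ℤ} {T : SuspData A}

lemma iterate_shift_apply (x : Space A) (n m : ℕ) : ((shift A)^[n] x).1 m = x.1 (m + n) := by
  induction n generalizing m with
  | zero => rfl
  | succ n ih =>
    rw [iterate_succ_apply']
    exact (ih (m + 1)).trans (by rw [add_right_comm, add_assoc])

lemma injective_restrict_periodic (A : Matrix (Fin N) (Fin N) ℤ) (n : ℕ) :
    Injective fun (x : {x : Space A // (shift A)^[n + 1] x = x}) (i : Fin (n + 1)) => x.1.1 i := by
  intro x y hxy
  refine Subtype.ext (Subtype.ext (funext fun m => ?_))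
  have key : ∀ x : {x : Space A // (shift A)^[n + 1] x = x}, x.1.1 m = x.1.1 (m % (n + 1)) := by
    intro x
    have h := IsPeriodicPt.iterate_mod_apply (f := shift A) (n := n + 1) x.2 m
    simpa [iterate_shift_apply] using congrArg (fun y => y.1 0) h.symm
  rw [key x, key y]
  exact congrFun hxy ⟨m % (n + 1), Nat.mod_lt _ n.succ_pos⟩

instance (A : Matrix (Fin N) (Fin N) ℤ) (n : ℕ) :
    Finite {x : Space A // (shift A)^[n + 1] x = x} :=
  Finite.of_injective _ (injective_restrict_periodic A n)

lemma card_periodic_le (A : Matrix (Fin N) (Fin N) ℤ) (n : ℕ) :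
    Nat.card {x : Space A // (shift A)^[n + 1] x = x} ≤ N ^ (n + 1) := by
  simpa using Nat.card_le_card_of_injective _ (injective_restrict_periodic A n)

/-- The term of the dynamical zeta function belonging to a point of period `n + 1`. -/
noncomputable def zetaTerm (T : SuspData A) (s : ℂ)
    (q : Σ n : ℕ, {x : Space A // (shift A)^[n + 1] x = x}) : ℂ :=
  1 / (q.1 + 1 : ℂ) * Complex.exp (-s * ((birkR A (cFun T) (q.1 + 1) q.2.1 : ℝ) : ℂ))

lemma summable_exp_neg_pow_periodic (A : Matrix (Fin N) (Fin N) ℤ) :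
    Summable fun q : Σ n : ℕ, {x : Space A // (shift A)^[n + 1] x = x} =>
      Real.exp (-N) ^ (q.1 + 1) := by
  refine (summable_sigma_of_nonneg fun _ => by positivity).2
    ⟨fun _ => Summable.of_finite, ?_⟩
  have hr : (N : ℝ) * Real.exp (-N) < 1 := by
    rw [Real.exp_neg, ← div_eq_mul_inv, div_lt_one (Real.exp_pos _)]
    linarith [Real.add_one_le_exp (N : ℝ)]
  refine Summable.of_nonneg_of_le (fun n => tsum_nonneg fun _ => by positivity) (fun n => ?_)
    ((summable_nat_add_iff 1).2 (summable_geometric_of_lt_one (by positivity) hr))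
  change ∑' _, Real.exp (-N) ^ (n + 1) ≤ _
  rw [tsum_const, nsmul_eq_mul, mul_pow]
  gcongr
  exact_mod_cast card_periodic_le A n

lemma summable_zeta_terms {n₀ : ℕ} (hn₀ : 0 < n₀)
    (hlin : ∀ (x : Space A) (n : ℕ), IsPeriodicPt (shift A) n x →
      (n : ℝ) ≤ n₀ * birkR A (cFun T) n x) {s : ℂ} (hs : n₀ * N < s.re) :
    Summable (zetaTerm T s) := by
  refine Summable.of_norm_bounded (summable_exp_neg_pow_periodic A) fun ⟨n, x, hx⟩ => ?_
  have h1 := hlin x (n + 1) hx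
  push_cast at h1
  have hn₀' : (0 : ℝ) < n₀ := by exact_mod_cast hn₀
  have hb : 0 < birkR A (cFun T) (n + 1) x :=
    pos_of_mul_pos_right (n.cast_add_one_pos.trans_le h1) hn₀'.le
  have h2 : (N : ℝ) * (n + 1) ≤ s.re * birkR A (cFun T) (n + 1) x := by
    nlinarith [mul_le_mul_of_nonneg_left h1 (Nat.cast_nonneg (α := ℝ) N),
      mul_le_mul_of_nonneg_right hs.le hb.le]
  have h3 : ‖(1 / (n + 1 : ℂ))‖ ≤ 1 := by
    rw [norm_div, norm_one, ← Nat.cast_add_one, Complex.norm_natCast]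
    exact div_le_one_of_le₀ (by simp) (Nat.cast_nonneg _)
  rw [zetaTerm, norm_mul, Complex.norm_exp, ← Real.exp_nat_mul]
  refine (mul_le_of_le_one_left (Real.exp_pos _).le h3).trans (Real.exp_le_exp.2 ?_)
  simp only [Nat.cast_add, Nat.cast_one, neg_mul, Complex.neg_re, Complex.re_mul_ofReal]
  linarith

/-- A period of a periodic point is a multiple of its minimal period. -/
noncomputable def periodicProdEquiv (A : Matrix (Fin N) (Fin N) ℤ) :
    periodicPts (shift A) × ℕ ≃ Σ n : ℕ, {x : Space A // (shift A)^[n + 1] x = x} where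
  toFun q := ⟨minimalPeriod (shift A) q.1.1 * (q.2 + 1) - 1, q.1.1, by
    rw [Nat.sub_add_cancel
      (Nat.mul_pos (minimalPeriod_pos_of_mem_periodicPts q.1.2) q.2.succ_pos)]
    exact (isPeriodicPt_minimalPeriod _ _).mul_const _⟩
  invFun q := (⟨q.2.1, mk_mem_periodicPts q.1.succ_pos q.2.2⟩,
    (q.1 + 1) / minimalPeriod (shift A) q.2.1 - 1)
  left_inv := by
    rintro ⟨⟨x, hx⟩, k⟩
    have hp := minimalPeriod_pos_of_mem_periodicPts hx
    refine Prod.ext rfl ?_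
    simp only
    rw [Nat.sub_add_cancel (Nat.mul_pos hp k.succ_pos), Nat.mul_div_cancel_left _ hp]
    rfl
  right_inv := by
    rintro ⟨n, x, hx⟩
    obtain ⟨k, hk⟩ := IsPeriodicPt.minimalPeriod_dvd (f := shift A) (n := n + 1) hx
    have hp := IsPeriodicPt.minimalPeriod_pos (f := shift A) n.succ_pos hx
    have hk0 : 0 < k := Nat.pos_of_ne_zero (by rintro rfl; simp at hk)
    have : minimalPeriod (shift A) x * ((n + 1) / minimalPeriod (shift A) x - 1 + 1) - 1 = n := by
      rw [hk, Nat.mul_div_cancel_left _ hp, Nat.sub_add_cancel hk0, ← hk, Nat.add_sub_cancel]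
    refine Sigma.ext this ?_
    simp only
    congr 1
    · funext y
      rw [this]
    · exact proof_irrel_heq _ _

lemma zetaTerm_periodicProdEquiv (s : ℂ) (x : periodicPts (shift A)) (k : ℕ) :
    zetaTerm T s (periodicProdEquiv A (x, k)) = (minimalPeriod (shift A) x.1 : ℂ)⁻¹ *
      (Complex.exp (-s * ((birkR A (cFun T) (minimalPeriod (shift A) x.1) x.1 : ℝ) : ℂ)) ^ (k + 1)
        / (k + 1)) := by
  have hp := minimalPeriod_pos_of_mem_periodicPts x.2
  have hm := Nat.sub_add_cancel (Nat.mul_pos hp k.succ_pos)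
  have hb := birkhoffSum_add_mul_of_isPeriodicPt (isPeriodicPt_minimalPeriod (shift A) x.1)
    (cFun T) 0 (k + 1)
  rw [zero_add, birkhoffSum_zero, zero_add] at hb
  change 1 / (((minimalPeriod (shift A) x.1 * (k + 1) - 1 : ℕ) : ℂ) + 1) * Complex.exp (-s *
    ((birkR A (cFun T) (minimalPeriod (shift A) x.1 * (k + 1) - 1 + 1) x.1 : ℝ) : ℂ)) = _
  rw [← Nat.cast_add_one, hm,
    show birkR A (cFun T) (minimalPeriod (shift A) x.1 * k.succ) x.1 = _ from hb,
    ← Complex.exp_nat_mul]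
  simp only [birkhoffSum, birkR, nsmul_eq_mul]
  push_cast
  rw [one_div, mul_inv, mul_assoc, div_eq_inv_mul]
  congr 3
  ring

end Zeta

theorem flow_zeta_eq_dynamical_zeta
    {N : ℕ} (A : Matrix (Fin N) (Fin N) ℤ)
    (hN : 1 < N) (hA01 : IsZeroOne A)
    (hAirr : IsIrreducible A) (hAnp : ¬ IsPermutationMatrix A)
    (T : SuspData A) (hT : IsSuspTriplet T) :
    ∃ h0 : ℝ, ∀ s : ℂ, h0 < s.re →
      (∏' τ : {τ : Set (Susp T) // IsFlowOrbit T τ},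
          (1 - Complex.exp (-s * ((orbitLen T τ.1 : ℝ) : ℂ)))⁻¹)
        = Complex.exp (∑' n : ℕ, (1 / (n + 1 : ℂ)) *
            ∑' x : {x : Space A // (shift A)^[n + 1] x = x},
              Complex.exp (-s * ((birkR A (cFun T) (n + 1) x.1 : ℝ) : ℂ))) := by
  obtain ⟨n₀, hn₀, hlin⟩ := hT.exists_le_birkR
  refine ⟨n₀ * N, fun s hs => ?_⟩
  have hs0 : 0 < s.re := lt_of_le_of_lt (by positivity) hs
  have hsum := summable_zeta_terms hn₀ hlin hs
  have hP := (periodicProdEquiv A).summable_iff.2 hsum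
  let z : periodicPts (shift A) → ℂ := fun x =>
    Complex.exp (-s * ((birkR A (cFun T) (minimalPeriod (shift A) x.1) x.1 : ℝ) : ℂ))
  have hz : ∀ x, ‖z x‖ < 1 := fun x => by
    have := mul_pos hs0 (hT.birkR_minimalPeriod_pos x.2)
    rw [Complex.norm_exp, Real.exp_lt_one_iff]
    simpa using this
  let G : periodicPts (shift A) → ℂ := fun x =>
    (minimalPeriod (shift A) x.1 : ℂ)⁻¹ * -Complex.log (1 - z x)
  have hfib : ∀ x : periodicPts (shift A), HasSum (fun k : ℕ =>
      (zetaTerm T s ∘ periodicProdEquiv A) (x, k)) (G x) := fun x => by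
    simp only [comp_apply, zetaTerm_periodicProdEquiv]
    exact (Complex.hasSum_taylorSeries_neg_log' (hz x)).mul_left _
  have hG : HasSum G (∑' q, zetaTerm T s q) := by
    rw [← (periodicProdEquiv A).tsum_eq]
    exact hP.hasSum.prod_fiberwise hfib
  let π : periodicPts (shift A) → {τ : Set (Susp T) // IsFlowOrbit T τ} := fun x =>
    ⟨liftOrbit hT x.1, isFlowOrbit_liftOrbit hT x.2⟩
  have hπ : Surjective π := fun τ =>
    let ⟨x, hx, h⟩ := τ.2.exists_eq_liftOrbit hT; ⟨⟨x, hx⟩, Subtype.ext h⟩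
  have hzπ : ∀ x, Complex.exp (-s * ((orbitLen T (π x).1 : ℝ) : ℂ)) = z x := fun x => by
    rw [orbitLen_liftOrbit hT x.2]
  have hL : HasSum (fun τ : {τ : Set (Susp T) // IsFlowOrbit T τ} =>
      -Complex.log (1 - Complex.exp (-s * ((orbitLen T τ.1 : ℝ) : ℂ))))
      (∑' q, zetaTerm T s q) := by
    refine ((Equiv.sigmaFiberEquiv π).hasSum_iff.2 hG).sigma fun τ => ?_
    obtain ⟨x, rfl⟩ := hπ τ
    have hp := minimalPeriod_pos_of_mem_periodicPts x.2
    have hcard : Nat.card {y // π y = π x} = minimalPeriod (shift A) x.1 := by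
      rw [← card_liftOrbit_eq hT x.2]
      exact Nat.card_congr (Equiv.subtypeEquivRight fun y => Subtype.ext_iff)
    have : Finite {y // π y = π x} := Nat.finite_of_card_ne_zero (by omega)
    have hconst : ∀ y : {y // π y = π x}, (G ∘ Equiv.sigmaFiberEquiv π) ⟨π x, y⟩ = G x := by
      rintro ⟨y, hy⟩
      obtain ⟨i, hi⟩ := (liftOrbit_eq_iff hT x.2 y.2).1 (congrArg Subtype.val hy)
      have hper : minimalPeriod (shift A) y.1 = minimalPeriod (shift A) x.1 := by
        rw [← hi, minimalPeriod_apply_iterate x.2]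
      change G y = G x
      simp only [G]
      rw [hper, ← hzπ y, hy, hzπ x]
    simp only [hconst]
    convert! (Summable.of_finite (f := fun _ : {y // π y = π x} => G x)).hasSum using 1
    have hp' : (minimalPeriod (shift A) x.1 : ℂ) ≠ 0 := by exact_mod_cast hp.ne'
    rw [tsum_const, hcard, nsmul_eq_mul, hzπ, mul_inv_cancel_left₀ hp']
    infer_instance
  have hE : Complex.exp (∑' q, zetaTerm T s q) = _ := hL.cexp.tprod_eq.symm
  have hR : ∑' q, zetaTerm T s q = ∑' n : ℕ, (1 / (n + 1 : ℂ)) *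
      ∑' x : {x : Space A // (shift A)^[n + 1] x = x},
        Complex.exp (-s * ((birkR A (cFun T) (n + 1) x.1 : ℝ) : ℂ)) := by
    rw [hsum.tsum_sigma]
    simp only [zetaTerm, tsum_mul_left]
  rw [← hR, hE]
  refine tprod_congr fun τ => ?_
  obtain ⟨x, rfl⟩ := hπ τ
  have hne : 1 - z x ≠ 0 := sub_ne_zero.2 fun h => by simpa [← h] using hz x
  rw [comp_apply, hzπ, Complex.exp_neg, Complex.exp_log hne]

end OneSidedMarkov
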